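/- arXiv:1111.2288 — 6 statements merged into one kernel-verified Lean document; each statement's English description precedes it below -/
import Mathlib

section
/- Let ζ = (ζ₁,ζ₂,ζ₃) ∈ ℝ³ and let α₁, α₂, α₃ ∈ ℝ, and let D = diag(α₁,α₂,α₃). Let M be the complex 3×3 matrix defined by M b = i ζ × (D b) for all b ∈ ℂ³. Then the characteristic polynomial of M is det(λ·I − M) = λ³ − S·λ, where S = ζ₁²α₂α₃ + ζ₂²α₃α₁ + ζ₃²α₁α₂. In particular the eigenvalues of M are 0, √S and −√S (with √S denoting a complex square root of S), and if S > 0 then M has the real positive eigenvalue √S. -/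
open Matrix Polynomial

/-- `μ` has a nonzero eigenvector for `M` if and only if it is a root of the characteristic
polynomial of `M`. -/
theorem exists_mulVec_eq_smul_iff_isRoot_charpoly {n K : Type*} [Fintype n] [DecidableEq n]
    [Field K] (M : Matrix n n K) (μ : K) :
    (∃ v : n → K, v ≠ 0 ∧ M.mulVec v = μ • v) ↔ M.charpoly.IsRoot μ := by
  rw [IsRoot.def, Matrix.eval_charpoly, ← Matrix.exists_mulVec_eq_zero_iff]
  refine exists_congr fun v => and_congr_right fun _ => ?_
  rw [Matrix.sub_mulVec, sub_eq_zero, Matrix.scalar_apply, ← Matrix.smul_one_eq_diagonal,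
    Matrix.smul_mulVec, Matrix.one_mulVec, eq_comm]

/-- The matrix of `b ↦ i z × (diag(a) b)`. -/
theorem eq_of_mulVec_eq_I_smul_cross_diagonal (z a : Fin 3 → ℂ) (M : Matrix (Fin 3) (Fin 3) ℂ)
    (hM : ∀ b : Fin 3 → ℂ,
      M.mulVec b = Complex.I • crossProduct z ((Matrix.diagonal a).mulVec b)) :
    M = Complex.I • !![0, -(z 2 * a 1), z 1 * a 2;
      z 2 * a 0, 0, -(z 0 * a 2);
      -(z 1 * a 0), z 0 * a 1, 0] := by
  ext i j
  have h := congrFun (hM (Pi.single j 1)) i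
  rw [Matrix.mulVec_single_one, Matrix.col_apply] at h
  rw [h]
  fin_cases i <;> fin_cases j <;> simp [cross_apply]

/-- The characteristic polynomial of `b ↦ i z × (diag(a) b)`. -/
theorem charpoly_of_mulVec_eq_I_smul_cross_diagonal (z a : Fin 3 → ℂ)
    (M : Matrix (Fin 3) (Fin 3) ℂ)
    (hM : ∀ b : Fin 3 → ℂ,
      M.mulVec b = Complex.I • crossProduct z ((Matrix.diagonal a).mulVec b)) :
    M.charpoly =
      X ^ 3 - C (z 0 ^ 2 * (a 1 * a 2) + z 1 ^ 2 * (a 2 * a 0) + z 2 ^ 2 * (a 0 * a 1)) * X := by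
  have hI : (C Complex.I : ℂ[X]) ^ 2 = -1 := by
    rw [← C_pow, Complex.I_sq, C_neg, C_1]
  rw [eq_of_mulVec_eq_I_smul_cross_diagonal z a M hM, Matrix.charpoly, Matrix.det_fin_three]
  simp
  linear_combination (X * (C (z 0) ^ 2 * (C (a 1) * C (a 2)) + C (z 1) ^ 2 * (C (a 2) * C (a 0)) +
    C (z 2) ^ 2 * (C (a 0) * C (a 1)))) * hI

/-- For `ζ ∈ ℝ³`, `D = diag(α₁,α₂,α₃)` and `M` the complex matrix with
`M b = i ζ × (D b)`, the characteristic polynomial of `M` is `λ³ − S λ` where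
`S = ζ₁²α₂α₃ + ζ₂²α₃α₁ + ζ₃²α₁α₂`; the eigenvalues of `M` are `0`, `√S`, `−√S`,
and if `S > 0` then `√S` is a real positive eigenvalue. -/
theorem stmt0 (ζ α : Fin 3 → ℝ)
    (D : Matrix (Fin 3) (Fin 3) ℂ) (hD : D = Matrix.diagonal (fun i => (α i : ℂ)))
    (M : Matrix (Fin 3) (Fin 3) ℂ)
    (hM : ∀ b : Fin 3 → ℂ,
      M.mulVec b = Complex.I • crossProduct (fun i => (ζ i : ℂ)) (D.mulVec b))
    (S : ℝ)
    (hS : S = (ζ 0) ^ 2 * (α 1 * α 2) + (ζ 1) ^ 2 * (α 2 * α 0) + (ζ 2) ^ 2 * (α 0 * α 1)) :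
    M.charpoly = X ^ 3 - C (S : ℂ) * X ∧
    (∀ sqS : ℂ, sqS ^ 2 = (S : ℂ) →
      ∀ μ : ℂ, (∃ v : Fin 3 → ℂ, v ≠ 0 ∧ M.mulVec v = μ • v) ↔
        (μ = 0 ∨ μ = sqS ∨ μ = -sqS)) ∧
    (0 < S → ∃ v : Fin 3 → ℂ, v ≠ 0 ∧ M.mulVec v = ((Real.sqrt S : ℝ) : ℂ) • v) := by
  subst hD
  have hchar : M.charpoly = X ^ 3 - C (S : ℂ) * X := by
    rw [charpoly_of_mulVec_eq_I_smul_cross_diagonal _ _ M hM, hS]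
    push_cast
    rfl
  have heig : ∀ sqS : ℂ, sqS ^ 2 = (S : ℂ) →
      ∀ μ : ℂ, (∃ v : Fin 3 → ℂ, v ≠ 0 ∧ M.mulVec v = μ • v) ↔
        (μ = 0 ∨ μ = sqS ∨ μ = -sqS) := by
    intro sqS hsq μ
    have hfac : μ ^ 3 - (S : ℂ) * μ = μ * ((μ - sqS) * (μ + sqS)) := by
      rw [← hsq]
      ring
    rw [exists_mulVec_eq_smul_iff_isRoot_charpoly, hchar, IsRoot.def]
    simp only [eval_sub, eval_pow, eval_mul, eval_X, eval_C]
    rw [hfac, mul_eq_zero, mul_eq_zero, sub_eq_zero, add_eq_zero_iff_eq_neg]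
  refine ⟨hchar, heig, fun hpos => (heig _ ?_ _).2 (Or.inr (Or.inl rfl))⟩
  exact_mod_cast Real.sq_sqrt hpos.le
end

section
/- Let α be a real 3×3 matrix whose symmetric part α^S = (α + αᵀ)/2 has all three eigenvalues nonzero. Then there exists ξ ∈ ℝ³, which may moreover be chosen with all coordinates in 2πℚ, such that the complex 3×3 matrix b ↦ i ξ × (α b) has an eigenvalue with strictly positive real part. -/
open Matrix

/-- The adjugate of an invertible real symmetric 3×3 matrix takes a positive value as a
quadratic form. -/
lemma exists_adjugate_quadraticForm_pos (S : Matrix (Fin 3) (Fin 3) ℝ) (hS : S.IsSymm)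
    (hdet : S.det ≠ 0) : ∃ x : Fin 3 → ℝ, 0 < x ⬝ᵥ S.adjugate *ᵥ x := by
  by_contra! hneg
  have hpsd : (-(S.det) • S).PosSemidef := by
    refine PosSemidef.of_dotProduct_mulVec_nonneg ?_ fun x => ?_
    · simp only [IsHermitian, conjTranspose_eq_transpose_of_trivial, transpose_smul, hS.eq]
    · have h := hneg (S *ᵥ x)
      rw [mulVec_mulVec, adjugate_mul, smul_mulVec, one_mulVec, dotProduct_smul,
        dotProduct_comm, smul_eq_mul] at h
      rw [smul_mulVec, dotProduct_smul, star_trivial, smul_eq_mul]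
      linarith
  have h := hpsd.det_nonneg
  rw [det_smul, Fintype.card_fin] at h
  have : 0 < S.det ^ 4 := by positivity
  linarith [show (-S.det) ^ 3 * S.det = -S.det ^ 4 by ring]

/-- A continuous real function on `ℝⁿ` that is positive somewhere is positive at a rational
point. -/
lemma exists_rat_pos_of_continuous {n : ℕ} {f : (Fin n → ℝ) → ℝ} (hf : Continuous f)
    (hpos : ∃ x, 0 < f x) : ∃ q : Fin n → ℚ, 0 < f fun i => (q i : ℝ) := by
  have hd : DenseRange (Pi.map fun (_ : Fin n) (q : ℚ) => (q : ℝ)) :=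
    DenseRange.piMap fun _ => Rat.denseRange_cast
  exact hd.exists_mem_open (isOpen_lt continuous_const hf) hpos

/-- If `s ^ 2` is the value at `x` of the quadratic form of the adjugate of the symmetric part
of `A`, then `b ↦ i x × (A b)` has an eigenvalue with real part `s`. -/
lemma exists_eigenvector_I_smul_crossProduct (A : Matrix (Fin 3) (Fin 3) ℝ) (x : Fin 3 → ℝ)
    (s : ℝ) (hs : s ^ 2 = x ⬝ᵥ ((2 : ℝ)⁻¹ • (A + Aᵀ)).adjugate *ᵥ x) :
    ∃ μ : ℂ, μ.re = s ∧ ∃ v : Fin 3 → ℂ, v ≠ 0 ∧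
      Complex.I • crossProduct (fun i => (x i : ℂ)) ((A.map Complex.ofReal).mulVec v)
        = μ • v := by
  set t : ℝ := x 0 * (A 1 2 - A 2 1) + x 1 * (A 2 0 - A 0 2) + x 2 * (A 0 1 - A 1 0) with ht
  set μ : ℂ := s + t / 2 * Complex.I with hμ
  let K : Matrix (Fin 3) (Fin 3) ℂ := !![0, -x 2, x 1; x 2, 0, -x 0; -x 1, x 0, 0]
  have hs' := congrArg Complex.ofReal hs
  simp only [adjugate_fin_three, dotProduct, mulVec, Fin.sum_univ_three, Matrix.smul_apply,
    Matrix.add_apply, transpose_apply, of_apply, cons_val', cons_val_zero, cons_val_one, cons_val,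
    smul_eq_mul] at hs'
  push_cast at hs'
  have hdet : (Complex.I • (K * A.map Complex.ofReal) - μ • (1 : Matrix _ _ ℂ)).det = 0 := by
    have hI : Complex.I ^ 2 = -1 := Complex.I_sq
    simp only [K, det_fin_three, Matrix.sub_apply, Matrix.smul_apply, mul_apply,
      Fin.sum_univ_three, map_apply, one_apply, of_apply, cons_val', cons_val_zero, cons_val_one,
      cons_val, smul_eq_mul, ↓reduceIte, Fin.reduceEq, zero_ne_one, one_ne_zero]
    have htC := congrArg Complex.ofReal ht
    push_cast at htC
    linear_combination (norm := skip) (-μ * s ^ 2) * hI + (μ * Complex.I ^ 2) * hs'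
    rw [hμ, htC]
    ring
  obtain ⟨v, hv, hv0⟩ := exists_mulVec_eq_zero_iff.mpr hdet
  refine ⟨μ, by simp [hμ], v, hv, ?_⟩
  rw [sub_mulVec, smul_mulVec, smul_mulVec, one_mulVec, sub_eq_zero, ← mulVec_mulVec] at hv0
  rw [← hv0]
  congr 1
  ext i
  fin_cases i <;> simp [K, cross_apply, mulVec, dotProduct, Fin.sum_univ_three] <;> ring

/-- Let `α` be a real 3×3 matrix whose symmetric part `αS = (α + αᵀ)/2`
has all its eigenvalues nonzero (i.e. `0` is not an eigenvalue of `αS`). Then there is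
`ξ ∈ ℝ³`, with all coordinates in `2πℚ`, such that the complex matrix
`b ↦ i ξ × (α b)` has an eigenvalue with strictly positive real part. -/
theorem stmt5 (A AS : Matrix (Fin 3) (Fin 3) ℝ)
    (hAS : AS = (2 : ℝ)⁻¹ • (A + Aᵀ))
    (h : ∀ μ : ℝ, (∃ v : Fin 3 → ℝ, v ≠ 0 ∧ AS.mulVec v = μ • v) → μ ≠ 0) :
    ∃ ξ : Fin 3 → ℝ, (∀ i, ∃ q : ℚ, ξ i = 2 * Real.pi * (q : ℝ)) ∧
      ∃ μ : ℂ, 0 < μ.re ∧ ∃ v : Fin 3 → ℂ, v ≠ 0 ∧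
        Complex.I • crossProduct (fun i => (ξ i : ℂ)) ((A.map Complex.ofReal).mulVec v)
          = μ • v := by
  have hdet : AS.det ≠ 0 := fun h0 => by
    obtain ⟨v, hv, hv0⟩ := exists_mulVec_eq_zero_iff.mpr h0
    exact h 0 ⟨v, hv, by rw [hv0, zero_smul]⟩ rfl
  have hsymm : AS.IsSymm := by
    rw [hAS, IsSymm, transpose_smul, transpose_add, transpose_transpose, add_comm]
  obtain ⟨q, hq⟩ := exists_rat_pos_of_continuous (f := fun x => x ⬝ᵥ AS.adjugate *ᵥ x)
    (by fun_prop) (exists_adjugate_quadraticForm_pos AS hsymm hdet)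
  set y : Fin 3 → ℝ := fun i => (q i : ℝ)
  have hpos : 0 < ((2 * Real.pi) • y) ⬝ᵥ AS.adjugate *ᵥ ((2 * Real.pi) • y) := by
    rw [mulVec_smul, dotProduct_smul, smul_dotProduct, smul_eq_mul, smul_eq_mul]
    have := Real.pi_pos
    positivity
  obtain ⟨μ, hμ, hv⟩ := exists_eigenvector_I_smul_crossProduct A ((2 * Real.pi) • y) _
    (by rw [Real.sq_sqrt hpos.le, hAS])
  exact ⟨_, fun i => ⟨q i, rfl⟩, μ, hμ ▸ Real.sqrt_pos.mpr hpos, hv⟩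
end

section
/- Let j ∈ ℕ and define the ℤ³-periodic vector fields V¹(θ) = ( sin(2π(j+1)θ₃) + cos(2π(j+1)θ₂), cos(2π(j+1)θ₃), sin(2π(j+1)θ₂) ), V²(θ) = ( sin(2π(j+2)θ₃), sin(2π(j+2)θ₁) + cos(2π(j+2)θ₃), cos(2π(j+2)θ₁) ), V³(θ) = ( cos(2π(j+3)θ₂), sin(2π(j+3)θ₁), sin(2π(j+3)θ₂) + cos(2π(j+3)θ₁) ). Then for every B ∈ ℂ³: (a) ∑_{k ∈ ℤ³, k≠0} V̂¹(−k) × ( (i k/|k|²) × ( V̂¹(k) × B ) ) = −(1/(j+1)) (0, B₂, B₃); (b) ∑_{k ∈ ℤ³, k≠0} V̂²(−k) × ( (i k/|k|²) × ( V̂²(k) × B ) ) = −(1/(j+2)) (B₁, 0, B₃); (c) ∑_{k ∈ ℤ³, k≠0} V̂³(−k) × ( (i k/|k|²) × ( V̂³(k) × B ) ) = −(1/(j+3)) (B₁, B₂, 0). (All three sums have only finitely many nonzero terms.) -/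
open Matrix MeasureTheory Real

/-- Fourier coefficient at `k ∈ ℤ³` of a `ℤ³`-periodic function `W : ℝ³ → ℂ³`. -/
noncomputable def fourierCoef (W : (Fin 3 → ℝ) → Fin 3 → ℂ) (k : Fin 3 → ℤ) :
    Fin 3 → ℂ := fun c =>
  ∫ θ in Set.Icc (0 : Fin 3 → ℝ) 1,
    Complex.exp (-(2 * Real.pi * Complex.I) * (∑ i, (k i : ℂ) * (θ i : ℂ))) * W θ c

/-- Fourier coefficient of a real-valued field. -/
noncomputable def fourierCoefR (W : (Fin 3 → ℝ) → Fin 3 → ℝ) (k : Fin 3 → ℤ) :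
    Fin 3 → ℂ := fourierCoef (fun θ c => ((W θ c : ℝ) : ℂ)) k

/-- The vector `i k / |k|² ∈ ℂ³` for `k ∈ ℤ³`. -/
noncomputable def ikOverNormSq (k : Fin 3 → ℤ) : Fin 3 → ℂ := fun i =>
  Complex.I * (k i : ℂ) / ((∑ l, ((k l : ℝ)) ^ 2 : ℝ) : ℂ)

noncomputable def V1 (j : ℕ) (θ : Fin 3 → ℝ) : Fin 3 → ℝ :=
  ![Real.sin (2 * π * (j + 1) * θ 2) + Real.cos (2 * π * (j + 1) * θ 1),
    Real.cos (2 * π * (j + 1) * θ 2),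
    Real.sin (2 * π * (j + 1) * θ 1)]

noncomputable def V2 (j : ℕ) (θ : Fin 3 → ℝ) : Fin 3 → ℝ :=
  ![Real.sin (2 * π * (j + 2) * θ 2),
    Real.sin (2 * π * (j + 2) * θ 0) + Real.cos (2 * π * (j + 2) * θ 2),
    Real.cos (2 * π * (j + 2) * θ 0)]

noncomputable def V3 (j : ℕ) (θ : Fin 3 → ℝ) : Fin 3 → ℝ :=
  ![Real.cos (2 * π * (j + 3) * θ 1),
    Real.sin (2 * π * (j + 3) * θ 0),
    Real.sin (2 * π * (j + 3) * θ 1) + Real.cos (2 * π * (j + 3) * θ 0)]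

theorem integral_Icc_exp_two_pi_int (m : ℤ) :
    ∫ t in Set.Icc (0 : ℝ) 1, Complex.exp (2 * π * Complex.I * ((m : ℂ) * (t : ℂ))) =
      if m = 0 then 1 else 0 := by
  rw [integral_Icc_eq_integral_Ioc, ← intervalIntegral.integral_of_le zero_le_one]
  split_ifs with h
  · simp [h]
  · have hc : 2 * π * Complex.I * (m : ℂ) ≠ 0 := by
      simp [h, Real.pi_ne_zero, Complex.I_ne_zero]
    simp_rw [← mul_assoc]
    rw [integral_exp_mul_complex hc]
    have h1 : Complex.exp (2 * π * Complex.I * (m : ℂ)) = 1 := by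
      rw [mul_comm]
      exact Complex.exp_int_mul_two_pi_mul_I m
    simp [h1]

theorem integral_exp_two_pi_dot (m : Fin 3 → ℤ) :
    ∫ θ in Set.Icc (0 : Fin 3 → ℝ) 1,
        Complex.exp (2 * π * Complex.I * ∑ i, (m i : ℂ) * (θ i : ℂ)) =
      if m = 0 then 1 else 0 := by
  have hvol : (volume : Measure (Fin 3 → ℝ)).restrict (Set.Icc 0 1) =
      Measure.pi fun _ => (volume : Measure ℝ).restrict (Set.Icc 0 1) := by
    rw [← Set.pi_univ_Icc, volume_pi, Measure.restrict_pi_pi]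
    rfl
  rw [hvol]
  simp_rw [Finset.mul_sum, Complex.exp_sum]
  rw [integral_fintype_prod_eq_prod
    (f := fun i (t : ℝ) => Complex.exp (2 * π * Complex.I * ((m i : ℂ) * (t : ℂ))))]
  simp_rw [integral_Icc_exp_two_pi_int]
  rw [Finset.prod_ite_zero]
  simp [funext_iff]

/-- The Fourier coefficients of a finite combination of characters. -/
theorem fourierCoef_sum_exp {ι : Type*} (s : Finset ι) (p : ι → Fin 3 → ℤ)
    (u : ι → Fin 3 → ℂ) (W : (Fin 3 → ℝ) → Fin 3 → ℂ)
    (hW : ∀ θ c, W θ c =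
      ∑ x ∈ s, Complex.exp (2 * π * Complex.I * ∑ i, (p x i : ℂ) * (θ i : ℂ)) * u x c)
    (k : Fin 3 → ℤ) :
    fourierCoef W k = ∑ x ∈ s, if p x = k then u x else 0 := by
  ext c
  have h : ∀ θ : Fin 3 → ℝ,
      Complex.exp (-(2 * π * Complex.I) * (∑ i, (k i : ℂ) * (θ i : ℂ))) * W θ c =
        ∑ x ∈ s, Complex.exp (2 * π * Complex.I *
          ∑ i, ((p x - k) i : ℤ) * (θ i : ℂ)) * u x c := by
    intro θ
    rw [hW, Finset.mul_sum]
    refine Finset.sum_congr rfl fun x _ => ?_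
    rw [← mul_assoc, ← Complex.exp_add]
    congr 2
    simp only [Pi.sub_apply, Int.cast_sub, sub_mul, Finset.sum_sub_distrib]
    ring
  simp only [fourierCoef, h]
  rw [integral_finsetSum]
  · rw [Finset.sum_apply]
    refine Finset.sum_congr rfl fun x _ => ?_
    rw [integral_mul_const, integral_exp_two_pi_dot]
    simp only [sub_eq_zero]
    split_ifs <;> simp
  · intro x _
    exact (Continuous.continuousOn (by fun_prop)).integrableOn_compact isCompact_Icc

theorem ikOverNormSq_single (a : Fin 3) (n : ℤ) :
    ikOverNormSq (Pi.single a n) = Pi.single a (Complex.I / n) := by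
  ext i
  have h : ∑ l, ((Pi.single a n : Fin 3 → ℤ) l : ℝ) ^ 2 = (n : ℝ) ^ 2 := by
    rw [Finset.sum_eq_single a] <;> simp +contextual
  rw [ikOverNormSq, h]
  rcases eq_or_ne i a with rfl | hi
  · rcases eq_or_ne n 0 with rfl | hn
    · simp
    · have : (n : ℂ) ≠ 0 := by exact_mod_cast hn
      simp
      field_simp
  · simp [hi]

/-- The `α`-effect sum for a field with two circular waves along the axes `a` and `b`. -/
theorem finsum_cross_two_waves (F : (Fin 3 → ℝ) → Fin 3 → ℝ) {a b : Fin 3} (hab : a ≠ b)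
    {n : ℤ} (hn : n ≠ 0) (P Q R S : Fin 3 → ℝ)
    (hF : ∀ θ c, F θ c = Real.cos (2 * π * n * θ a) * P c + Real.sin (2 * π * n * θ a) * Q c +
      (Real.cos (2 * π * n * θ b) * R c + Real.sin (2 * π * n * θ b) * S c))
    (B : Fin 3 → ℂ) :
    ∑ᶠ (k : Fin 3 → ℤ) (_ : k ≠ 0),
        crossProduct (fourierCoefR F (-k))
          (crossProduct (ikOverNormSq k) (crossProduct (fourierCoefR F k) B)) =
      crossProduct (fun c => (P c + Complex.I * Q c) / 2)
        (crossProduct (Pi.single a (Complex.I / n))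
          (crossProduct (fun c => (P c - Complex.I * Q c) / 2) B)) +
      crossProduct (fun c => (P c - Complex.I * Q c) / 2)
        (crossProduct (Pi.single a (-(Complex.I / n)))
          (crossProduct (fun c => (P c + Complex.I * Q c) / 2) B)) +
      (crossProduct (fun c => (R c + Complex.I * S c) / 2)
        (crossProduct (Pi.single b (Complex.I / n))
          (crossProduct (fun c => (R c - Complex.I * S c) / 2) B)) +
      crossProduct (fun c => (R c - Complex.I * S c) / 2)
        (crossProduct (Pi.single b (-(Complex.I / n)))
          (crossProduct (fun c => (R c + Complex.I * S c) / 2) B))) := by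
  have key : ∀ k, fourierCoefR F k = ∑ x : Fin 4,
      if (![Pi.single a n, Pi.single a (-n), Pi.single b n, Pi.single b (-n)] :
          Fin 4 → Fin 3 → ℤ) x = k then
        (![fun c => (P c - Complex.I * Q c) / 2, fun c => (P c + Complex.I * Q c) / 2,
          fun c => (R c - Complex.I * S c) / 2, fun c => (R c + Complex.I * S c) / 2] :
          Fin 4 → Fin 3 → ℂ) x else 0 := by
    refine fourierCoef_sum_exp _ _ _ _ fun θ c => ?_
    have hs : ∀ (d : Fin 3) (m : ℤ),
        ∑ i, ((Pi.single d m : Fin 3 → ℤ) i : ℂ) * (θ i : ℂ) = m * θ d := by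
      intro d m
      rw [Finset.sum_eq_single d] <;> simp +contextual
    have he : ∀ d : Fin 3, Complex.exp (2 * π * Complex.I * (n * θ d)) =
        Complex.cos (2 * π * n * θ d) + Complex.sin (2 * π * n * θ d) * Complex.I := by
      intro d
      rw [← Complex.exp_mul_I]
      ring_nf
    have he' : ∀ d : Fin 3, Complex.exp (2 * π * Complex.I * (-n * θ d)) =
        Complex.cos (2 * π * n * θ d) - Complex.sin (2 * π * n * θ d) * Complex.I := by
      intro d
      rw [sub_eq_add_neg, ← neg_mul, ← Complex.sin_neg, ← Complex.cos_neg, ← Complex.exp_mul_I]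
      ring_nf
    simp only [Fin.sum_univ_four, Matrix.cons_val, hs, hF]
    push_cast
    rw [he, he, he', he']
    ring_nf
    rw [Complex.I_sq]
    ring
  have hna : Pi.single a (-n) ≠ (Pi.single a n : Fin 3 → ℤ) := fun h => by
    have := congrFun h a
    simp at this
    omega
  have hnb : Pi.single b (-n) ≠ (Pi.single b n : Fin 3 → ℤ) := fun h => by
    have := congrFun h b
    simp at this
    omega
  have hd : ∀ m m' : ℤ, m ≠ 0 → Pi.single a m ≠ (Pi.single b m' : Fin 3 → ℤ) :=
    fun m m' hm h => hm (by simpa [hab] using congrFun h a)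
  have h1 := hd n n hn
  have h2 := hd n (-n) hn
  have h3 := hd (-n) n (neg_ne_zero.2 hn)
  have h4 := hd (-n) (-n) (neg_ne_zero.2 hn)
  simp only [Fin.sum_univ_four, Matrix.cons_val] at key
  have ka : fourierCoefR F (Pi.single a n) = fun c => (P c - Complex.I * Q c) / 2 := by
    rw [key]; simp [hna, h1.symm, h2.symm]
  have ka' : fourierCoefR F (Pi.single a (-n)) = fun c => (P c + Complex.I * Q c) / 2 := by
    rw [key]; simp [hna.symm, h3.symm, h4.symm]
  have kb : fourierCoefR F (Pi.single b n) = fun c => (R c - Complex.I * S c) / 2 := by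
    rw [key]; simp [hnb, h1, h3]
  have kb' : fourierCoefR F (Pi.single b (-n)) = fun c => (R c + Complex.I * S c) / 2 := by
    rw [key]; simp [hnb.symm, h2, h4]
  refine (finsum_mem_eq_sum_of_inter_support_eq (s := {k | k ≠ 0}) _
    (t := {Pi.single a n, Pi.single a (-n), Pi.single b n, Pi.single b (-n)}) ?_).trans ?_
  rotate_left
  · rw [Finset.sum_insert (by simp [hna.symm, h1, h2]), Finset.sum_insert (by simp [h3, h4]),
      Finset.sum_insert (by simp [hnb.symm]), Finset.sum_singleton]
    simp only [← Pi.single_neg, neg_neg, ikOverNormSq_single, ka, ka', kb, kb']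
    simp only [Int.cast_neg, div_neg, add_assoc]
  · ext k
    simp only [Set.mem_inter_iff, Function.mem_support, Finset.mem_coe, Set.mem_ofPred_eq,
      Finset.mem_insert, Finset.mem_singleton]
    refine and_congr_left fun hk => ⟨fun _ => ?_, ?_⟩
    · by_contra! hne
      apply hk
      have : fourierCoefR F k = 0 := by
        rw [key]
        simp [hne.1.symm, hne.2.1.symm, hne.2.2.1.symm, hne.2.2.2.symm]
      simp [this]
    · rintro (rfl | rfl | rfl | rfl) <;> simp [hn]

/-- the `α`-effect sums for the fields `V¹, V², V³`:
`∑_{k≠0} V̂ⁱ(−k) × ((ik/|k|²) × (V̂ⁱ(k) × B))` equals `−(1/(j+i))` times the projection of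
`B` killing the `i`-th coordinate. -/
theorem stmt8 (j : ℕ) (B : Fin 3 → ℂ) :
    (∑ᶠ (k : Fin 3 → ℤ) (_ : k ≠ 0),
        crossProduct (fourierCoefR (V1 j) (-k))
          (crossProduct (ikOverNormSq k) (crossProduct (fourierCoefR (V1 j) k) B)) =
      (-(1 / ((j : ℂ) + 1))) • ![0, B 1, B 2]) ∧
    (∑ᶠ (k : Fin 3 → ℤ) (_ : k ≠ 0),
        crossProduct (fourierCoefR (V2 j) (-k))
          (crossProduct (ikOverNormSq k) (crossProduct (fourierCoefR (V2 j) k) B)) =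
      (-(1 / ((j : ℂ) + 2))) • ![B 0, 0, B 2]) ∧
    (∑ᶠ (k : Fin 3 → ℤ) (_ : k ≠ 0),
        crossProduct (fourierCoefR (V3 j) (-k))
          (crossProduct (ikOverNormSq k) (crossProduct (fourierCoefR (V3 j) k) B)) =
      (-(1 / ((j : ℂ) + 3))) • ![B 0, B 1, 0]) := by
  have hc (i : ℕ) : ((j : ℂ) + (i + 1 : ℕ)) ≠ 0 := by norm_cast
  have hc1 := hc 0
  have hc2 := hc 1
  have hc3 := hc 2
  norm_num at hc1 hc2 hc3
  refine ⟨?_, ?_, ?_⟩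
  · rw [finsum_cross_two_waves (V1 j) (a := 1) (b := 2) (by decide) (n := j + 1) (by omega)
      ![1, 0, 0] ![0, 0, 1] ![0, 1, 0] ![1, 0, 0]]
    · ext c
      fin_cases c <;> simp [cross_apply] <;> field_simp <;> simp <;> ring
    · intro θ c
      fin_cases c <;> simp [V1, add_comm]
  · rw [finsum_cross_two_waves (V2 j) (a := 0) (b := 2) (by decide) (n := j + 2) (by omega)
      ![0, 0, 1] ![0, 1, 0] ![0, 1, 0] ![1, 0, 0]]
    · ext c
      fin_cases c <;> simp [cross_apply] <;> field_simp <;> simp <;> ring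
    · intro θ c
      fin_cases c <;> simp [V2]
  · rw [finsum_cross_two_waves (V3 j) (a := 1) (b := 0) (by decide) (n := j + 3) (by omega)
      ![1, 0, 0] ![0, 0, 1] ![0, 0, 1] ![0, 1, 0]]
    · ext c
      fin_cases c <;> simp [cross_apply] <;> field_simp <;> simp <;> ring
    · intro θ c
      fin_cases c <;> simp [V3]
end

section
/- Let j ∈ ℕ and let V¹, V², V³ be the ℤ³-periodic vector fields V¹(θ) = ( sin(2π(j+1)θ₃) + cos(2π(j+1)θ₂), cos(2π(j+1)θ₃), sin(2π(j+1)θ₂) ), V²(θ) = ( sin(2π(j+2)θ₃), sin(2π(j+2)θ₁) + cos(2π(j+2)θ₃), cos(2π(j+2)θ₁) ), V³(θ) = ( cos(2π(j+3)θ₂), sin(2π(j+3)θ₁), sin(2π(j+3)θ₂) + cos(2π(j+3)θ₁) ). Let W : ℝ³ → ℂ³ be a ℤ³-periodic trigonometric polynomial whose Fourier coefficients satisfy Ŵ(k) = 0 whenever |k| > j. Then for all distinct i, l ∈ {1,2,3}, all k ∈ ℤ³ with k ≠ 0, and all B ∈ ℂ³: V̂ⁱ(−k) × ( (i k/|k|²)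 × ( V̂ˡ(k) × B ) ) = 0, and Ŵ(−k) × ( (i k/|k|²) × ( V̂ⁱ(k) × B ) ) = 0 = V̂ⁱ(−k) × ( (i k/|k|²) × ( Ŵ(k) × B ) ). -/
open Matrix MeasureTheory Real

/-- The family `V¹, V², V³`. -/
noncomputable def Vfam (j : ℕ) : Fin 3 → (Fin 3 → ℝ) → Fin 3 → ℝ := ![V1 j, V2 j, V3 j]

/-- The character `θ ↦ exp (2πi m·θ)` has zero mean over the unit cube when `m ≠ 0`. -/
theorem integral_cube_exp_eq_zero (m : Fin 3 → ℤ) (hm : m ≠ 0) :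
    ∫ θ in Set.Icc (0 : Fin 3 → ℝ) 1,
      Complex.exp (2 * Real.pi * Complex.I * (∑ i, (m i : ℂ) * (θ i : ℂ))) = 0 := by
  obtain ⟨d, hd⟩ := Function.ne_iff.mp hm
  have hset : Set.Icc (0 : Fin 3 → ℝ) 1 = Set.univ.pi fun _ => Set.Icc (0 : ℝ) 1 :=
    (Set.pi_univ_Icc (0 : Fin 3 → ℝ) 1).symm
  have hfun : ∀ θ : Fin 3 → ℝ,
      Complex.exp (2 * Real.pi * Complex.I * (∑ i, (m i : ℂ) * (θ i : ℂ))) =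
        ∏ i, Complex.exp (2 * Real.pi * Complex.I * (m i : ℂ) * (θ i : ℂ)) := by
    intro θ
    rw [← Complex.exp_sum, Finset.mul_sum]
    simp only [mul_assoc]
  simp only [hfun]
  rw [hset, volume_pi, Measure.restrict_pi_pi,
    integral_fintype_prod_eq_prod (𝕜 := ℂ)
      (f := fun i (x : ℝ) => Complex.exp (2 * Real.pi * Complex.I * (m i : ℂ) * (x : ℂ)))]
  refine Finset.prod_eq_zero (Finset.mem_univ d) ?_
  have hc : (2 * Real.pi * Complex.I * (m d : ℂ)) ≠ 0 := by
    have : (m d : ℂ) ≠ 0 := by exact_mod_cast hd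
    exact mul_ne_zero Complex.two_pi_I_ne_zero this
  rw [integral_Icc_eq_integral_Ioc, ← intervalIntegral.integral_of_le zero_le_one,
    integral_exp_mul_complex hc]
  have h1 : Complex.exp (2 * Real.pi * Complex.I * (m d : ℂ)) = 1 := by
    rw [mul_comm]
    exact Complex.exp_int_mul_two_pi_mul_I (m d)
  simp [h1]

/-- `f` is continuous and its Fourier coefficient at `k` vanishes. -/
def HasZeroCoef (k : Fin 3 → ℤ) (f : (Fin 3 → ℝ) → ℂ) : Prop :=
  Continuous f ∧ ∫ θ in Set.Icc (0 : Fin 3 → ℝ) 1,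
    Complex.exp (-(2 * Real.pi * Complex.I) * (∑ i, (k i : ℂ) * (θ i : ℂ))) * f θ = 0

theorem HasZeroCoef.add {k : Fin 3 → ℤ} {f g : (Fin 3 → ℝ) → ℂ}
    (hf : HasZeroCoef k f) (hg : HasZeroCoef k g) : HasZeroCoef k fun θ => f θ + g θ := by
  refine ⟨hf.1.add hg.1, ?_⟩
  have hint : ∀ h : (Fin 3 → ℝ) → ℂ, Continuous h → IntegrableOn (fun θ =>
      Complex.exp (-(2 * Real.pi * Complex.I) * (∑ i, (k i : ℂ) * (θ i : ℂ))) * h θ)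
      (Set.Icc (0 : Fin 3 → ℝ) 1) := fun h hh =>
    Continuous.integrableOn_Icc (by fun_prop)
  simp only [mul_add]
  rw [integral_add (hint f hf.1) (hint g hg.1), hf.2, hg.2, add_zero]

theorem HasZeroCoef.const_mul {k : Fin 3 → ℤ} {f : (Fin 3 → ℝ) → ℂ} (c : ℂ)
    (hf : HasZeroCoef k f) : HasZeroCoef k fun θ => c * f θ := by
  refine ⟨hf.1.const_mul c, ?_⟩
  simp only [mul_left_comm _ c]
  rw [integral_const_mul, hf.2, mul_zero]

theorem hasZeroCoef_exp {k : Fin 3 → ℤ} {n : ℤ} (hk : ∑ i, k i ^ 2 ≠ n ^ 2) (d : Fin 3) :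
    HasZeroCoef k fun θ => Complex.exp (2 * Real.pi * Complex.I * ((n : ℂ) * (θ d : ℂ))) := by
  refine ⟨by fun_prop, ?_⟩
  have hm : Pi.single d n - k ≠ 0 := by
    intro h
    apply hk
    rw [← sub_eq_zero.mp h, Finset.sum_eq_single d] <;> simp +contextual
  rw [← integral_cube_exp_eq_zero _ hm]
  congr 1
  funext θ
  rw [← Complex.exp_add]
  congr 1
  have : ∑ i, ((Pi.single d n : Fin 3 → ℤ) i : ℂ) * (θ i : ℂ) = n * θ d := by
    rw [Finset.sum_eq_single d] <;> simp +contextual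
  simp only [Pi.sub_apply, Int.cast_sub, sub_mul, Finset.sum_sub_distrib, this]
  ring

theorem hasZeroCoef_cos {k : Fin 3 → ℤ} {n : ℤ} (hk : ∑ i, k i ^ 2 ≠ n ^ 2) (d : Fin 3) :
    HasZeroCoef k fun θ => Complex.cos (2 * Real.pi * n * θ d) := by
  have h := ((hasZeroCoef_exp hk d).add
    (hasZeroCoef_exp (n := -n) (by simpa using hk) d)).const_mul (1 / 2)
  convert h using 2 with θ
  rw [Complex.cos]
  push_cast
  ring_nf

theorem hasZeroCoef_sin {k : Fin 3 → ℤ} {n : ℤ} (hk : ∑ i, k i ^ 2 ≠ n ^ 2) (d : Fin 3) :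
    HasZeroCoef k fun θ => Complex.sin (2 * Real.pi * n * θ d) := by
  have h := ((hasZeroCoef_exp hk d).const_mul (-Complex.I / 2)).add
    ((hasZeroCoef_exp (n := -n) (by simpa using hk) d).const_mul (Complex.I / 2))
  convert h using 2 with θ
  rw [Complex.sin]
  push_cast
  ring_nf

/-- The Fourier coefficients of `Vfam j a` are supported on the sphere of radius `j + a + 1`. -/
theorem fourierCoefR_Vfam_eq_zero (j : ℕ) (a : Fin 3) (k : Fin 3 → ℤ)
    (hk : ∑ i, k i ^ 2 ≠ ((j : ℤ) + (a : ℕ) + 1) ^ 2) : fourierCoefR (Vfam j a) k = 0 := by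
  have hc := hasZeroCoef_cos hk
  have hs := hasZeroCoef_sin hk
  funext c
  suffices h : HasZeroCoef k fun θ => ((Vfam j a θ c : ℝ) : ℂ) from h.2
  fin_cases a <;> fin_cases c <;>
    simp [Vfam, V1, V2, V3, add_assoc] at hc hs ⊢ <;>
    first
    | exact (hs _).add (hc _)
    | exact hs _
    | exact hc _

/-- all crossed terms vanish: for `i ≠ l`, all `k ≠ 0` and all `B ∈ ℂ³`,
`V̂ⁱ(−k) × ((ik/|k|²) × (V̂ˡ(k) × B)) = 0`, and likewise for the crossed terms between a
trigonometric polynomial `W` with `Ŵ(k) = 0` for `|k| > j` and any `Vⁱ`. -/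
theorem stmt9 (j : ℕ) (W : (Fin 3 → ℝ) → Fin 3 → ℂ)
    (hWpoly : ∃ c : (Fin 3 → ℤ) → Fin 3 → ℂ, (Function.support c).Finite ∧
      ∀ θ m, W θ m = ∑ᶠ k : Fin 3 → ℤ,
        c k m * Complex.exp (2 * Real.pi * Complex.I * (∑ i, (k i : ℂ) * (θ i : ℂ))))
    (hWj : ∀ k : Fin 3 → ℤ, (j : ℝ) < Real.sqrt (∑ i, ((k i : ℝ)) ^ 2) →
      fourierCoef W k = 0) :
    ∀ a b : Fin 3, a ≠ b → ∀ k : Fin 3 → ℤ, k ≠ 0 → ∀ B : Fin 3 → ℂ,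
      (crossProduct (fourierCoefR (Vfam j a) (-k))
          (crossProduct (ikOverNormSq k) (crossProduct (fourierCoefR (Vfam j b) k) B)) = 0) ∧
      (crossProduct (fourierCoef W (-k))
          (crossProduct (ikOverNormSq k) (crossProduct (fourierCoefR (Vfam j a) k) B)) = 0) ∧
      (crossProduct (fourierCoefR (Vfam j a) (-k))
          (crossProduct (ikOverNormSq k) (crossProduct (fourierCoef W k) B)) = 0) := by
  intro a b hab k _ B
  have hneg : ∑ i, (-k) i ^ 2 = ∑ i, k i ^ 2 := by simp
  refine ⟨?_, ?_⟩
  · by_cases ha : ∑ i, k i ^ 2 = ((j : ℤ) + (a : ℕ) + 1) ^ 2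
    · have hb : fourierCoefR (Vfam j b) k = 0 := by
        refine fourierCoefR_Vfam_eq_zero j b k fun hb => hab (Fin.ext ?_)
        have := (sq_eq_sq₀ (by positivity) (by positivity)).mp (ha.symm.trans hb)
        omega
      simp [hb]
    · simp [fourierCoefR_Vfam_eq_zero j a (-k) (hneg.trans_ne ha)]
  · by_cases ha : ∑ i, k i ^ 2 = ((j : ℤ) + (a : ℕ) + 1) ^ 2
    · have hW : ∀ l : Fin 3 → ℤ, ∑ i, l i ^ 2 = ∑ i, k i ^ 2 → fourierCoef W l = 0 := by
        intro l hl
        refine hWj l (Real.lt_sqrt_of_sq_lt ?_)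
        have : (j : ℤ) ^ 2 < ∑ i, l i ^ 2 := by
          rw [hl, ha]
          gcongr
          omega
        exact_mod_cast this
      simp [hW k rfl, hW (-k) hneg]
    · simp [fourierCoefR_Vfam_eq_zero j a k ha,
        fourierCoefR_Vfam_eq_zero j a (-k) (hneg.trans_ne ha)]
end

section
/- For a ℤ³-periodic trigonometric polynomial W : ℝ³ → ℂ³, define the 3×3 complex matrix α⁽²⁾(W) by α⁽²⁾(W) b = ∑_{k ∈ ℤ³, k≠0} Ŵ(−k) × ( (i k/|k|²) × ( Ŵ(k) × b ) ) for b ∈ ℂ³. Let j ∈ ℕ, let U^j be a real-valued ℤ³-periodic trigonometric polynomial with Û^j(k) = 0 whenever |k| > j, let δ₁, δ₂, δ₃ ∈ ℝ, and set Ũ = U^j + δ₁V¹ + δ₂V² + δ₃V³, where V¹, V², V³ are the vector fields V¹(θ) = ( sin(2π(j+1)θ₃) + cos(2π(j+1)θ₂), cos(2π(j+1)θ₃), sin(2π(j+1)θ₂) ), V²(θ) = ( sin(2π(j+2)θ₃), sin(2π(j+2)θ₁) + cos(2π(j+2)θ₃), cos(2π(j+2)θ₁) ), V³(θ) = ( cos(2π(j+3)θ₂),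 sin(2π(j+3)θ₁), sin(2π(j+3)θ₂) + cos(2π(j+3)θ₁) ). Then α⁽²⁾(Ũ) = α⁽²⁾(U^j) − (δ₁²/(j+1)) diag(0,1,1) − (δ₂²/(j+2)) diag(1,0,1) − (δ₃²/(j+3)) diag(1,1,0). -/
open Matrix MeasureTheory Real

/-- The map `b ↦ α⁽²⁾(W) b = ∑_{k≠0} Ŵ(−k) × ((ik/|k|²) × (Ŵ(k) × b))`. -/
noncomputable def alpha2 (W : (Fin 3 → ℝ) → Fin 3 → ℝ) (b : Fin 3 → ℂ) : Fin 3 → ℂ :=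
  ∑ᶠ (k : Fin 3 → ℤ) (_ : k ≠ 0),
    crossProduct (fourierCoefR W (-k))
      (crossProduct (ikOverNormSq k) (crossProduct (fourierCoefR W k) b))

/-- The trigonometric polynomial with coefficients `c`, evaluated at `θ`. -/
noncomputable def trigEval (θ : Fin 3 → ℝ) :
    ((Fin 3 → ℤ) →₀ (Fin 3 → ℂ)) →ₗ[ℂ] (Fin 3 → ℂ) :=
  Finsupp.lsum ℂ fun k =>
    Complex.exp (2 * π * Complex.I * ∑ i, (k i : ℂ) * (θ i : ℂ)) • LinearMap.id

lemma trigEval_single (θ : Fin 3 → ℝ) (k : Fin 3 → ℤ) (v : Fin 3 → ℂ) :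
    trigEval θ (Finsupp.single k v) =
      Complex.exp (2 * π * Complex.I * ∑ i, (k i : ℂ) * (θ i : ℂ)) • v := by
  simp [trigEval]

lemma trigEval_apply (θ : Fin 3 → ℝ) (c : (Fin 3 → ℤ) →₀ (Fin 3 → ℂ)) (m : Fin 3) :
    trigEval θ c m = ∑ k ∈ c.support,
      c k m * Complex.exp (2 * π * Complex.I * ∑ i, (k i : ℂ) * (θ i : ℂ)) := by
  simp [trigEval, Finsupp.sum, Finset.sum_apply, mul_comm]

lemma integral_exp_int (n : ℤ) :
    ∫ x in Set.Icc (0 : ℝ) 1, Complex.exp (2 * π * Complex.I * n * x) =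
      if n = 0 then 1 else 0 := by
  rw [integral_Icc_eq_integral_Ioc, ← intervalIntegral.integral_of_le zero_le_one]
  split_ifs with h
  · simp [h]
  · have hc : (2 * π * Complex.I * n : ℂ) ≠ 0 := by
      simp [h, Real.pi_ne_zero]
    rw [integral_exp_mul_complex hc]
    have : (2 * π * Complex.I * n : ℂ) = n * (2 * π * Complex.I) := by ring
    simp [this, Complex.exp_int_mul_two_pi_mul_I]

lemma integral_exp_cube (k : Fin 3 → ℤ) :
    ∫ θ in Set.Icc (0 : Fin 3 → ℝ) 1,
      Complex.exp (2 * π * Complex.I * ∑ i, (k i : ℂ) * (θ i : ℂ)) =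
      if k = 0 then 1 else 0 := by
  have hm : (volume : Measure (Fin 3 → ℝ)).restrict (Set.Icc 0 1) =
      Measure.pi fun _ => (volume : Measure ℝ).restrict (Set.Icc 0 1) := by
    rw [← Set.pi_univ_Icc, volume_pi, Measure.restrict_pi_pi]
    rfl
  have he : ∀ θ : Fin 3 → ℝ,
      Complex.exp (2 * π * Complex.I * ∑ i, (k i : ℂ) * (θ i : ℂ)) =
        ∏ i, Complex.exp (2 * π * Complex.I * k i * θ i) := fun θ => by
    rw [← Complex.exp_sum, Finset.mul_sum]
    simp [mul_assoc]
  simp_rw [he]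
  rw [hm, integral_fintype_prod_eq_prod
    (f := fun i (x : ℝ) => Complex.exp (2 * π * Complex.I * k i * x))]
  simp_rw [integral_exp_int]
  rw [Finset.prod_ite_zero]
  simp [funext_iff]

lemma fourierCoefR_eq_of_trigEval (W : (Fin 3 → ℝ) → Fin 3 → ℝ)
    (c : (Fin 3 → ℤ) →₀ (Fin 3 → ℂ)) (h : ∀ θ m, (W θ m : ℂ) = trigEval θ c m) :
    fourierCoefR W = c := by
  funext k m
  have he : ∀ θ : Fin 3 → ℝ,
      Complex.exp (-(2 * π * Complex.I) * ∑ i, (k i : ℂ) * (θ i : ℂ)) * (W θ m : ℂ) =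
        ∑ l ∈ c.support, c l m *
          Complex.exp (2 * π * Complex.I * ∑ i, ((l - k) i : ℂ) * (θ i : ℂ)) := fun θ => by
    rw [h, trigEval_apply, Finset.mul_sum]
    refine Finset.sum_congr rfl fun l _ => ?_
    rw [mul_left_comm, ← Complex.exp_add]
    congr 2
    simp only [Fin.sum_univ_three, Pi.sub_apply]
    push_cast
    ring
  simp only [fourierCoefR, fourierCoef]
  simp_rw [he]
  rw [integral_finsetSum]
  · simp_rw [integral_const_mul, integral_exp_cube, sub_eq_zero]
    by_cases hk : c k = 0 <;> simp [hk]
  · intro l _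
    exact (Continuous.continuousOn (by fun_prop)).integrableOn_compact isCompact_Icc

/-- The summand of `alpha2` for the frequency `k`, in terms of the Fourier coefficients. -/
noncomputable def alphaTerm (c : (Fin 3 → ℤ) → Fin 3 → ℂ) (b : Fin 3 → ℂ) (k : Fin 3 → ℤ) :
    Fin 3 → ℂ :=
  crossProduct (c (-k)) (crossProduct (ikOverNormSq k) (crossProduct (c k) b))

lemma alphaTerm_zero (c : (Fin 3 → ℤ) → Fin 3 → ℂ) (b : Fin 3 → ℂ) :
    alphaTerm c b 0 = 0 := by
  have : ikOverNormSq 0 = 0 := by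
    funext i
    simp [ikOverNormSq]
  simp [alphaTerm, this]

lemma alpha2_eq (W : (Fin 3 → ℝ) → Fin 3 → ℝ) (b : Fin 3 → ℂ) :
    alpha2 W b = ∑ᶠ k, alphaTerm (fourierCoefR W) b k := by
  refine finsum_congr fun k => ?_
  by_cases hk : k = 0
  · simp [hk, alphaTerm_zero]
  · simp [hk, alphaTerm]

lemma support_alphaTerm_subset (c : (Fin 3 → ℤ) →₀ (Fin 3 → ℂ)) (b : Fin 3 → ℂ) :
    Function.support (alphaTerm c b) ⊆ c.support := by
  intro k hk
  simp only [Finset.mem_coe, Finsupp.mem_support_iff]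
  intro h
  exact hk (by simp [alphaTerm, h])

lemma finsum_alphaTerm_add_pair (G : (Fin 3 → ℤ) →₀ (Fin 3 → ℂ)) (b : Fin 3 → ℂ)
    {k : Fin 3 → ℤ} (hk : k ≠ 0) (h₁ : G k = 0) (h₂ : G (-k) = 0) (v w : Fin 3 → ℂ) :
    ∑ᶠ l, alphaTerm (G + (Finsupp.single k v + Finsupp.single (-k) w) :
        (Fin 3 → ℤ) →₀ (Fin 3 → ℂ)) b l =
      ∑ᶠ l, alphaTerm G b l +
        (crossProduct w (crossProduct (ikOverNormSq k) (crossProduct v b)) +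
          crossProduct v (crossProduct (ikOverNormSq (-k)) (crossProduct w b))) := by
  have hne : k ≠ -k := fun h => hk (self_eq_neg.mp h)
  have key : ∀ l, alphaTerm (G + (Finsupp.single k v + Finsupp.single (-k) w) :
      (Fin 3 → ℤ) →₀ (Fin 3 → ℂ)) b l = alphaTerm G b l +
        (Finsupp.single k (crossProduct w (crossProduct (ikOverNormSq k) (crossProduct v b))) +
        Finsupp.single (-k) (crossProduct v (crossProduct (ikOverNormSq (-k))
          (crossProduct w b)))) l := by
    intro l
    by_cases hl : l = k
    · subst hl
      simp [alphaTerm, h₁, h₂, hne, hne.symm]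
    by_cases hl' : l = -k
    · subst hl'
      simp [alphaTerm, h₁, h₂, hne, hne.symm]
    have e₁ : k ≠ -l := fun h => hl' (by rw [h, neg_neg])
    simp [alphaTerm, Ne.symm hl, Ne.symm hl', e₁]
  set D := Finsupp.single k (crossProduct w (crossProduct (ikOverNormSq k) (crossProduct v b))) +
        Finsupp.single (-k) (crossProduct v (crossProduct (ikOverNormSq (-k))
          (crossProduct w b))) with hD
  rw [finsum_congr key, finsum_add_distrib
    ((Finset.finite_toSet _).subset (support_alphaTerm_subset G b)) D.hasFiniteSupport]
  congr 1
  rw [hD, finsum_congr fun l => Finsupp.add_apply _ _ l,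
    finsum_add_distrib (Finsupp.hasFiniteSupport _) (Finsupp.hasFiniteSupport _)]
  congr 1
  · rw [finsum_eq_single _ k fun l hl => Finsupp.single_eq_of_ne hl, Finsupp.single_eq_same]
  · rw [finsum_eq_single _ (-k) fun l hl => Finsupp.single_eq_of_ne hl, Finsupp.single_eq_same]

/-- The Fourier coefficients of the helical shear flow of amplitude `δ` and frequency `n`
along the axis `l`. -/
noncomputable def axisMode (l : Fin 3) (n : ℤ) (δ : ℂ) : (Fin 3 → ℤ) →₀ (Fin 3 → ℂ) :=
  Finsupp.single (Pi.single l n)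
      (δ • (Pi.single (l + 1) (-Complex.I / 2) + Pi.single (l + 2) (1 / 2))) +
    Finsupp.single (-Pi.single l n)
      (δ • (Pi.single (l + 1) (Complex.I / 2) + Pi.single (l + 2) (1 / 2)))

lemma trigEval_axisMode (θ : Fin 3 → ℝ) (l : Fin 3) (n : ℤ) (δ : ℂ) :
    trigEval θ (axisMode l n δ) =
      δ • (Pi.single (l + 1) (Complex.sin (2 * π * n * θ l)) +
        Pi.single (l + 2) (Complex.cos (2 * π * n * θ l))) := by
  have h₁ : ∑ i, (((Pi.single l n : Fin 3 → ℤ) i : ℤ) : ℂ) * (θ i : ℂ) = n * θ l := by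
    rw [Finset.sum_eq_single l] <;> simp +contextual
  have h₂ : ∑ i, (((-Pi.single l n : Fin 3 → ℤ) i : ℤ) : ℂ) * (θ i : ℂ) = -(n * θ l) := by
    rw [← h₁]
    simp
  have a₁ : (2 * π * Complex.I * (n * θ l) : ℂ) = (2 * π * n * θ l) * Complex.I := by ring
  have a₂ : (2 * π * Complex.I * -(n * θ l) : ℂ) = -(2 * π * n * θ l) * Complex.I := by ring
  rw [axisMode, map_add, trigEval_single, trigEval_single, h₁, h₂, a₁, a₂, Complex.sin,
    Complex.cos]
  funext m
  simp only [Pi.add_apply, Pi.smul_apply, smul_eq_mul, Pi.single_apply]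
  fin_cases l <;> fin_cases m <;> simp <;> ring

lemma finsum_alphaTerm_add_axisMode (G : (Fin 3 → ℤ) →₀ (Fin 3 → ℂ)) (b : Fin 3 → ℂ)
    (l : Fin 3) {n : ℤ} (hn : n ≠ 0) (δ : ℂ)
    (h₁ : G (Pi.single l n) = 0) (h₂ : G (-Pi.single l n) = 0) :
    ∑ᶠ k, alphaTerm (G + axisMode l n δ : (Fin 3 → ℤ) →₀ (Fin 3 → ℂ)) b k =
      ∑ᶠ k, alphaTerm G b k - (δ ^ 2 / n) • Pi.single l (b l) := by
  have hn' : (n : ℂ) ≠ 0 := by exact_mod_cast hn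
  rw [axisMode, finsum_alphaTerm_add_pair G b (by simpa using hn) h₁ h₂, sub_eq_add_neg]
  congr 1
  have hi : ∀ s : ℤ, s ^ 2 = 1 → ikOverNormSq (s • Pi.single l n) =
      Pi.single l (s * Complex.I / n) := by
    intro s hs
    have hs' : (s : ℂ) ^ 2 = 1 := by exact_mod_cast hs
    funext i
    fin_cases l <;> fin_cases i <;>
      simp [ikOverNormSq, Fin.sum_univ_three, mul_pow, hs'] <;> field_simp
  have hp := hi 1 (by norm_num)
  have hm := hi (-1) (by norm_num)
  simp only [one_smul, neg_smul] at hp hm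
  rw [hp, hm]
  funext m
  fin_cases l <;> fin_cases m <;> simp [cross_apply] <;> ring_nf <;> simp [Complex.I_sq]

lemma axisMode_apply_eq_zero {l l' : Fin 3} {n n' : ℤ} (hn : 0 < n) (hn' : 0 < n') (δ : ℂ)
    (h : l ≠ l' ∨ n ≠ n') :
    axisMode l n δ (Pi.single l' n') = 0 ∧ axisMode l n δ (-Pi.single l' n') = 0 := by
  have e₁ : (Pi.single l n : Fin 3 → ℤ) ≠ Pi.single l' n' := fun e => by
    have := congrFun e l
    by_cases hl : l = l'
    · subst hl; simp_all
    · simp [hl] at this; omega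
  have e₂ : -(Pi.single l n : Fin 3 → ℤ) ≠ Pi.single l' n' := fun e => by
    have := congrFun e l
    by_cases hl : l = l'
    · subst hl; simp at this; omega
    · simp [hl] at this; omega
  have e₃ : (Pi.single l n : Fin 3 → ℤ) ≠ -Pi.single l' n' := fun e => e₂ (by rw [e, neg_neg])
  constructor <;> simp [axisMode, e₁, e₂, e₃]

/-- with `Ũ = Uʲ + δ₁V¹ + δ₂V² + δ₃V³`, where `Uʲ` is a real trigonometric
polynomial whose Fourier coefficients vanish for `|k| > j`, one has
`α⁽²⁾(Ũ) = α⁽²⁾(Uʲ) − (δ₁²/(j+1)) diag(0,1,1) − (δ₂²/(j+2)) diag(1,0,1) − (δ₃²/(j+3)) diag(1,1,0)`. -/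
theorem stmt10 (j : ℕ) (Uj : (Fin 3 → ℝ) → Fin 3 → ℝ)
    (hUpoly : ∃ c : (Fin 3 → ℤ) → Fin 3 → ℂ, (Function.support c).Finite ∧
      ∀ θ m, ((Uj θ m : ℝ) : ℂ) = ∑ᶠ k : Fin 3 → ℤ,
        c k m * Complex.exp (2 * Real.pi * Complex.I * (∑ i, (k i : ℂ) * (θ i : ℂ))))
    (hUj : ∀ k : Fin 3 → ℤ, (j : ℝ) < Real.sqrt (∑ i, ((k i : ℝ)) ^ 2) →
      fourierCoefR Uj k = 0)
    (δ₁ δ₂ δ₃ : ℝ)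
    (Ut : (Fin 3 → ℝ) → Fin 3 → ℝ)
    (hUt : ∀ θ, Ut θ = Uj θ + δ₁ • V1 j θ + δ₂ • V2 j θ + δ₃ • V3 j θ) :
    ∀ b : Fin 3 → ℂ,
      alpha2 Ut b = alpha2 Uj b
        - ((δ₁ ^ 2 / (j + 1) : ℝ) : ℂ) •
            (Matrix.diagonal (![0, 1, 1] : Fin 3 → ℂ)).mulVec b
        - ((δ₂ ^ 2 / (j + 2) : ℝ) : ℂ) •
            (Matrix.diagonal (![1, 0, 1] : Fin 3 → ℂ)).mulVec b
        - ((δ₃ ^ 2 / (j + 3) : ℝ) : ℂ) •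
            (Matrix.diagonal (![1, 1, 0] : Fin 3 → ℂ)).mulVec b := by
  obtain ⟨c₀, hfin, hc₀⟩ := hUpoly
  intro b
  set c : (Fin 3 → ℤ) →₀ (Fin 3 → ℂ) := Finsupp.ofSupportFinite c₀ hfin
  have hU : ∀ θ m, (Uj θ m : ℂ) = trigEval θ c m := fun θ m => by
    rw [hc₀, trigEval_apply]
    refine finsum_eq_sum_of_support_subset _ fun k hk => ?_
    simp only [Finset.mem_coe, Finsupp.mem_support_iff]
    intro h
    have h' : c₀ k = 0 := h
    exact hk (by simp [h'])
  have hcU := fourierCoefR_eq_of_trigEval Uj c hU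
  have hc : ∀ (l : Fin 3) (n : ℤ), (j : ℤ) < n →
      c (Pi.single l n) = 0 ∧ c (-Pi.single l n) = 0 := by
    intro l n hn
    have hn' : (j : ℝ) < n := by exact_mod_cast hn
    have hn0 : (0 : ℝ) ≤ n := (Nat.cast_nonneg j).trans hn'.le
    have hs : ∑ i, (((Pi.single l n : Fin 3 → ℤ) i : ℤ) : ℝ) ^ 2 = (n : ℝ) ^ 2 := by
      fin_cases l <;> simp [Fin.sum_univ_three]
    rw [← hcU]
    constructor <;> apply hUj
    · rwa [hs, Real.sqrt_sq hn0]
    · simp only [Pi.neg_apply, Int.cast_neg, neg_sq]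
      rwa [hs, Real.sqrt_sq hn0]
  set n₁ : ℤ := j + 1 with hn₁
  set n₂ : ℤ := j + 2 with hn₂
  set n₃ : ℤ := j + 3 with hn₃
  have p₁ : 0 < n₁ := by omega
  have p₂ : 0 < n₂ := by omega
  have p₃ : 0 < n₃ := by omega
  have hUtc : ∀ θ m, (Ut θ m : ℂ) = trigEval θ (c + axisMode 2 n₁ δ₁ + axisMode 1 n₁ δ₁ +
      axisMode 2 n₂ δ₂ + axisMode 0 n₂ δ₂ + axisMode 1 n₃ δ₃ + axisMode 0 n₃ δ₃) m := by
    intro θ m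
    simp only [map_add, trigEval_axisMode, hUt, Pi.add_apply, Complex.ofReal_add, hU]
    fin_cases m <;> simp [V1, V2, V3, hn₁, hn₂, hn₃] <;> ring
  rw [alpha2_eq, alpha2_eq, fourierCoefR_eq_of_trigEval Ut _ hUtc, hcU,
    finsum_alphaTerm_add_axisMode _ b 0 p₃.ne', finsum_alphaTerm_add_axisMode _ b 1 p₃.ne',
    finsum_alphaTerm_add_axisMode _ b 0 p₂.ne', finsum_alphaTerm_add_axisMode _ b 2 p₂.ne',
    finsum_alphaTerm_add_axisMode _ b 1 p₁.ne', finsum_alphaTerm_add_axisMode _ b 2 p₁.ne']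
  · funext m
    fin_cases m <;> simp [Matrix.mulVec_diagonal, hn₁, hn₂, hn₃]
  all_goals
    simp (disch := first | omega | (left; decide) | (right; omega)) only
      [Finsupp.add_apply, axisMode_apply_eq_zero, hc, add_zero]
end

section
/- Let ρ > 0, η ∈ (0,1), C' > 0, M > 0, ε > 0 and δ > 0. Let x : [0,∞) → [0,∞) be a continuous function with x(0) = 0, and suppose T = sup { t > 0 : ∀ s ∈ [0,t], x(s) ≤ ½ δ e^{ρ s} M } is finite. Assume moreover that x(t) ≤ C' δ^{1+η} ε^{1−η} e^{(1+η)ρ t} for all t ∈ [0,T]. Then x(T) = ½ δ e^{ρ T} M, the inequality ½ M ≤ C' δ^{η} ε^{1−η} e^{η ρ T} holds, and consequently T ≥ (1/(ηρ)) · ln( M / (2 C' δ^{η} ε^{1−η}) ). -/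
open Filter Topology in
/-- At a finite supremum of the times up to which `f ≤ g` holds, continuous functions agree. -/
theorem eq_of_isLUB_forall_Icc_le {f g : ℝ → ℝ} {T : ℝ} (hf : ContinuousOn f (Set.Ici 0))
    (hg : ContinuousOn g (Set.Ici 0))
    (hne : {t : ℝ | 0 < t ∧ ∀ s ∈ Set.Icc 0 t, f s ≤ g s}.Nonempty)
    (hT : IsLUB {t : ℝ | 0 < t ∧ ∀ s ∈ Set.Icc 0 t, f s ≤ g s} T) :
    0 < T ∧ f T = g T := by
  obtain ⟨t₀, ht₀⟩ := hne
  have hT0 : 0 < T := ht₀.1.trans_le (hT.1 ht₀)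
  have hfT : ContinuousAt f T := hf.continuousAt (Ici_mem_nhds hT0)
  have hgT : ContinuousAt g T := hg.continuousAt (Ici_mem_nhds hT0)
  have hlt : ∀ s, 0 ≤ s → s < T → f s ≤ g s := by
    intro s hs hsT
    obtain ⟨t, ht, hst, -⟩ := hT.exists_between hsT
    exact ht.2 s ⟨hs, hst.le⟩
  have hle : f T ≤ g T := by
    refine le_of_tendsto_of_tendsto (b := 𝓝[<] T) (hfT.mono_left nhdsWithin_le_nhds)
      (hgT.mono_left nhdsWithin_le_nhds) ?_
    filter_upwards [Ioo_mem_nhdsLT hT0] with s hs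
    exact hlt s hs.1.le hs.2
  refine ⟨hT0, hle.eq_of_not_lt fun h => ?_⟩
  obtain ⟨r, hr, hball⟩ := Metric.eventually_nhds_iff.1 (hfT.eventually_lt hgT h)
  have hmem : T + r / 2 ∈ {t : ℝ | 0 < t ∧ ∀ s ∈ Set.Icc 0 t, f s ≤ g s} := by
    refine ⟨by linarith, fun s hs => ?_⟩
    rcases lt_or_ge s T with hsT | hsT
    · exact hlt s hs.1 hsT
    · refine (hball ?_).le
      rw [Real.dist_eq, abs_of_nonneg (sub_nonneg.2 hsT)]
      linarith [hs.2]
  linarith [hT.1 hmem]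

/-- the bootstrap estimate of the nonlinear instability argument.
If `x : [0,∞) → [0,∞)` is continuous with `x(0) = 0`,
`T = sup { t > 0 : ∀ s ∈ [0,t], x(s) ≤ ½ δ e^{ρ s} M }` is finite (the set is nonempty
and bounded above), and `x(t) ≤ C' δ^{1+η} ε^{1−η} e^{(1+η)ρ t}` on `[0,T]`, then
`x(T) = ½ δ e^{ρ T} M`, `½ M ≤ C' δ^η ε^{1−η} e^{ηρT}`, and
`T ≥ (1/(ηρ)) ln(M/(2C' δ^η ε^{1−η}))`. -/
theorem stmt15 (ρ η C' M ε δ : ℝ) (hρ : 0 < ρ) (hη0 : 0 < η) (hη1 : η < 1)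
    (hC' : 0 < C') (hM : 0 < M) (hε : 0 < ε) (hδ : 0 < δ)
    (x : ℝ → ℝ) (hx0 : x 0 = 0) (hxnn : ∀ t, 0 ≤ t → 0 ≤ x t)
    (hxcont : ContinuousOn x (Set.Ici (0 : ℝ)))
    (T : ℝ)
    (hne : {t : ℝ | 0 < t ∧ ∀ s ∈ Set.Icc 0 t,
      x s ≤ 1 / 2 * δ * Real.exp (ρ * s) * M}.Nonempty)
    (hbdd : BddAbove {t : ℝ | 0 < t ∧ ∀ s ∈ Set.Icc 0 t,
      x s ≤ 1 / 2 * δ * Real.exp (ρ * s) * M})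
    (hT : T = sSup {t : ℝ | 0 < t ∧ ∀ s ∈ Set.Icc 0 t,
      x s ≤ 1 / 2 * δ * Real.exp (ρ * s) * M})
    (hgrow : ∀ t ∈ Set.Icc 0 T,
      x t ≤ C' * δ ^ (1 + η) * ε ^ (1 - η) * Real.exp ((1 + η) * ρ * t)) :
    x T = 1 / 2 * δ * Real.exp (ρ * T) * M ∧
    1 / 2 * M ≤ C' * δ ^ η * ε ^ (1 - η) * Real.exp (η * ρ * T) ∧
    T ≥ 1 / (η * ρ) * Real.log (M / (2 * C' * δ ^ η * ε ^ (1 - η))) := by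
  obtain ⟨hT0, hxT⟩ := eq_of_isLUB_forall_Icc_le hxcont
    (g := fun s => 1 / 2 * δ * Real.exp (ρ * s) * M) (by fun_prop) hne
    (hT ▸ isLUB_csSup hne hbdd)
  have hbound : 1 / 2 * M ≤ C' * δ ^ η * ε ^ (1 - η) * Real.exp (η * ρ * T) := by
    have h := hgrow T ⟨hT0.le, le_rfl⟩
    rw [hxT, Real.rpow_add hδ, Real.rpow_one,
      show (1 + η) * ρ * T = ρ * T + η * ρ * T by ring, Real.exp_add] at h
    refine le_of_mul_le_mul_left ?_ (mul_pos hδ (Real.exp_pos (ρ * T)))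
    linarith
  refine ⟨hxT, hbound, ?_⟩
  have hK : 0 < 2 * C' * δ ^ η * ε ^ (1 - η) := by positivity
  have hlog : Real.log (M / (2 * C' * δ ^ η * ε ^ (1 - η))) ≤ η * ρ * T := by
    rw [Real.log_le_iff_le_exp (div_pos hM hK), div_le_iff₀ hK]
    linarith
  rw [ge_iff_le, one_div_mul_eq_div, div_le_iff₀' (mul_pos hη0 hρ)]
  exact hlog
end
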